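/- Let L be an N×N Hermitian positive semidefinite complex matrix with orthonormal eigenbasis, let 𝒮 ⊆ {1,…,N} be a sampling set with complement 𝒮ᶜ, and let σ²_min denote the smallest eigenvalue of the principal submatrix of L² on the rows and columns indexed by 𝒮ᶜ. Let ω ≥ 0 satisfy ω < σ_min. If f and g both lie in the span of the eigenvectors of L whose eigenvalues are at most ω, and f(u) = g(u) for all u ∈ 𝒮, then f = g. In particular, any such ω-bandlimited signal is uniquely determined by its samples on 𝒮. -/

import Mathlib

open scoped ComplexOrder

open Matrix

section HermitianForm

variable {n : Type*} [Fintype n] [DecidableEq n] {A : Matrix n n ℂ}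

lemma Matrix.IsHermitian.inner_toEuclideanLin_apply_self (hA : A.IsHermitian)
    (x : EuclideanSpace ℂ n) :
    inner ℂ (toEuclideanLin A x) (toEuclideanLin A x) =
      inner ℂ x (toEuclideanLin (A * A) x) := by
  rw [isSymmetric_toEuclideanLin_iff.mpr hA]
  simp [toLpLin_apply]

lemma Matrix.IsHermitian.inner_eigenvectorBasis_toEuclideanLin (hA : A.IsHermitian) (i : n)
    (x : EuclideanSpace ℂ n) :
    inner ℂ (hA.eigenvectorBasis i) (toEuclideanLin A x) =
      (hA.eigenvalues i : ℂ) * inner ℂ (hA.eigenvectorBasis i) x := by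
  have h : toEuclideanLin A (hA.eigenvectorBasis i) =
      (hA.eigenvalues i : ℂ) • hA.eigenvectorBasis i := by
    ext j
    simpa [toLpLin_apply] using congrFun (hA.mulVec_eigenvectorBasis i) j
  rw [← isSymmetric_toEuclideanLin_iff.mpr hA, h, inner_smul_left, Complex.conj_ofReal]

lemma Matrix.IsHermitian.iInf_eigenvalues_mul_norm_sq_le (hA : A.IsHermitian)
    (x : EuclideanSpace ℂ n) :
    (⨅ i, hA.eigenvalues i) * ‖x‖ ^ 2 ≤ (inner ℂ x (toEuclideanLin A x)).re := by
  rw [← hA.eigenvectorBasis.sum_sq_norm_inner_right x,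
    ← hA.eigenvectorBasis.sum_inner_mul_inner, Complex.re_sum, Finset.mul_sum]
  refine Finset.sum_le_sum fun i _ ↦ ?_
  have h : inner ℂ x (hA.eigenvectorBasis i) *
      inner ℂ (hA.eigenvectorBasis i) (toEuclideanLin A x) =
      ((hA.eigenvalues i * ‖inner ℂ (hA.eigenvectorBasis i) x‖ ^ 2 : ℝ) : ℂ) := by
    rw [hA.inner_eigenvectorBasis_toEuclideanLin, mul_left_comm, ← inner_conj_symm,
      Complex.conj_mul']
    push_cast
    rfl
  rw [h, Complex.ofReal_re]
  gcongr
  exact ciInf_le (Set.finite_range _).bddBelow i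

lemma Matrix.PosSemidef.norm_toEuclideanLin_sq_le_of_mem_span (hA : A.IsHermitian)
    (hpsd : A.PosSemidef) {ω : ℝ} {x : EuclideanSpace ℂ n}
    (hx : x ∈ Submodule.span ℂ
      {v : EuclideanSpace ℂ n | ∃ i, hA.eigenvalues i ≤ ω ∧ v = hA.eigenvectorBasis i}) :
    ‖toEuclideanLin A x‖ ^ 2 ≤ ω ^ 2 * ‖x‖ ^ 2 := by
  have hzero : ∀ i, ω < hA.eigenvalues i → inner ℂ (hA.eigenvectorBasis i) x = 0 := by
    intro i hi
    induction hx using Submodule.span_induction with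
    | mem v hv =>
      obtain ⟨j, hj, rfl⟩ := hv
      exact hA.eigenvectorBasis.orthonormal.2 (by rintro rfl; linarith)
    | zero => simp
    | add u v _ _ hu hv => rw [inner_add_right, hu, hv, add_zero]
    | smul c v _ hv => rw [inner_smul_right, hv, mul_zero]
  rw [← hA.eigenvectorBasis.sum_sq_norm_inner_right x,
    ← hA.eigenvectorBasis.sum_sq_norm_inner_right, Finset.mul_sum]
  refine Finset.sum_le_sum fun i _ ↦ ?_
  rw [hA.inner_eigenvectorBasis_toEuclideanLin, norm_mul, mul_pow]
  rcases lt_or_ge ω (hA.eigenvalues i) with hi | hi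
  · simp [hzero i hi]
  · have hnonneg : 0 ≤ hA.eigenvalues i := hpsd.eigenvalues_nonneg i
    rw [Complex.norm_real, Real.norm_of_nonneg hnonneg]
    gcongr

end HermitianForm

section Restriction

variable {n : Type*} [Fintype n] {s : Finset n} {x : EuclideanSpace ℂ n}

lemma sum_subtype_mul_eq_sum_of_support (hx : ∀ i ∉ s, x i = 0) (a : n → ℂ) :
    ∑ i : {i // i ∈ s}, a i * x i = ∑ i, a i * x i := by
  rw [Finset.sum_coe_sort s fun i ↦ a i * x i]
  exact Finset.sum_subset (Finset.subset_univ s) fun i _ hi ↦ by simp [hx i hi]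
lemma norm_restrict_sq_eq_of_support (hx : ∀ i ∉ s, x i = 0) :
    ‖(WithLp.toLp 2 fun i : {i // i ∈ s} ↦ x i : EuclideanSpace ℂ {i // i ∈ s})‖ ^ 2 =
      ‖x‖ ^ 2 := by
  rw [EuclideanSpace.norm_sq_eq, EuclideanSpace.norm_sq_eq,
    Finset.sum_coe_sort s fun i ↦ ‖x i‖ ^ 2]
  exact Finset.sum_subset (Finset.subset_univ s) fun i _ hi ↦ by simp [hx i hi]

lemma inner_restrict_submatrix_eq_of_support [DecidableEq n] (hx : ∀ i ∉ s, x i = 0)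
    (A : Matrix n n ℂ) :
    inner ℂ (WithLp.toLp 2 fun i : {i // i ∈ s} ↦ x i : EuclideanSpace ℂ {i // i ∈ s})
      (toEuclideanLin (A.submatrix (fun i : {i // i ∈ s} ↦ (i : n))
        (fun i : {i // i ∈ s} ↦ (i : n))) (WithLp.toLp 2 fun i : {i // i ∈ s} ↦ x i)) =
      inner ℂ x (toEuclideanLin A x) := by
  simp only [PiLp.inner_apply, toLpLin_apply, mulVec, dotProduct, submatrix_apply,
    sum_subtype_mul_eq_sum_of_support hx]
  rw [Finset.sum_coe_sort s fun i ↦ inner ℂ (x i) (∑ j, A i j * x j)]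
  exact Finset.sum_subset (Finset.subset_univ s) fun i _ hi ↦ by simp [hx i hi]

end Restriction

/-- Let `L` be Hermitian positive semidefinite (with its orthonormal eigenbasis
`hL.eigenvectorBasis`), let `𝒮` be a sampling set with complement `𝒮ᶜ`, and let `σ²_min` be the
smallest eigenvalue of the principal submatrix of `L²` on `𝒮ᶜ`. If `0 ≤ ω < σ_min` and `f`, `g`
both lie in the span of the eigenvectors of `L` with eigenvalues at most `ω`, and `f = g` on `𝒮`,
then `f = g`: an `ω`-bandlimited signal is uniquely determined by its samples on `𝒮`. -/
theorem bandlimited_unique_reconstruction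
    (N : ℕ) (L : Matrix (Fin N) (Fin N) ℂ)
    (hL : L.IsHermitian) (hpsd : L.PosSemidef)
    (𝒮 : Finset (Fin N))
    (hsub : ((L * L).submatrix (fun i : {x // x ∈ 𝒮ᶜ} => (i : Fin N))
        (fun i : {x // x ∈ 𝒮ᶜ} => (i : Fin N))).IsHermitian)
    (σ2min : ℝ) (hσ : σ2min = ⨅ i, hsub.eigenvalues i)
    (ω : ℝ) (hω0 : 0 ≤ ω) (hω : ω < Real.sqrt σ2min)
    (f g : EuclideanSpace ℂ (Fin N))
    (hf : f ∈ Submodule.span ℂ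
        {v : EuclideanSpace ℂ (Fin N) | ∃ i, hL.eigenvalues i ≤ ω ∧ v = hL.eigenvectorBasis i})
    (hg : g ∈ Submodule.span ℂ
        {v : EuclideanSpace ℂ (Fin N) | ∃ i, hL.eigenvalues i ≤ ω ∧ v = hL.eigenvectorBasis i})
    (hsame : ∀ u ∈ 𝒮, f u = g u) :
    f = g := by
  have hspan := Submodule.sub_mem _ hf hg
  have hsupp : ∀ u ∉ 𝒮ᶜ, (f - g) u = 0 := fun u hu ↦ by
    simp [hsame u (by simpa using hu)]
  rw [← sub_eq_zero]
  generalize f - g = x at hspan hsupp ⊢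
  have hupper := hpsd.norm_toEuclideanLin_sq_le_of_mem_span hL hspan
  have hlower := hsub.iInf_eigenvalues_mul_norm_sq_le (WithLp.toLp 2 fun i ↦ x i)
  rw [norm_restrict_sq_eq_of_support hsupp, inner_restrict_submatrix_eq_of_support hsupp,
    ← hL.inner_toEuclideanLin_apply_self, ← hσ] at hlower
  have hnorm : (inner ℂ (toEuclideanLin L x) (toEuclideanLin L x)).re =
      ‖toEuclideanLin L x‖ ^ 2 := inner_self_eq_norm_sq (𝕜 := ℂ) _
  rw [hnorm] at hlower
  have hlt : ω ^ 2 < σ2min := (Real.lt_sqrt hω0).mp hω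
  by_contra hx
  have hpos : 0 < ‖x‖ ^ 2 := by positivity
  nlinarith
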